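/- arXiv:2512.20461 — 4 statements merged into one kernel-verified Lean document; each statement's English description precedes it below -/
import Mathlib

section
/- There exists an injective group homomorphism ι : SL(2, 𝔽₃) → SL(2, ℤ₃) that is a section of reduction modulo 3: composing ι with the group homomorphism SL(2, ℤ₃) → SL(2, 𝔽₃) induced by the canonical ring homomorphism ℤ₃ → ℤ/3ℤ gives the identity on SL(2, 𝔽₃). -/
instance : Fact (Nat.Prime 3) := ⟨by norm_num⟩

open scoped Quaternion

/-- The matrix of an integral quaternion under the splitting of the Hamilton quaternions over a
ring containing a square root `s` of `-2`. -/
def quaternionToMatrix {R : Type*} [CommRing R] (s : R) (q : ℍ[ℤ]) : Matrix (Fin 2) (Fin 2) R :=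
  !![q.re + q.imJ - s * q.imK, -q.imI + s * q.imJ + q.imK;
    q.imI + s * q.imJ + q.imK, q.re - q.imJ + s * q.imK]

theorem quaternionToMatrix_mul {R : Type*} [CommRing R] {s : R} (hs : s ^ 2 = -2) (x y : ℍ[ℤ]) :
    quaternionToMatrix s (x * y) = quaternionToMatrix s x * quaternionToMatrix s y := by
  ext i j
  fin_cases i <;> fin_cases j <;> simp [quaternionToMatrix] <;> grind

theorem det_quaternionToMatrix {R : Type*} [CommRing R] {s : R} (hs : s ^ 2 = -2) (q : ℍ[ℤ]) :
    (quaternionToMatrix s q).det =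
      ((q.re ^ 2 + q.imI ^ 2 + q.imJ ^ 2 + q.imK ^ 2 : ℤ) : R) := by
  simp [quaternionToMatrix, Matrix.det_fin_two]
  grind

theorem quaternionToMatrix_two_mul {R : Type*} [CommRing R] (s : R) (q : ℍ[ℤ]) :
    quaternionToMatrix s (2 * q) = (2 : R) • quaternionToMatrix s q := by
  rw [two_mul]
  ext i j
  fin_cases i <;> fin_cases j <;> simp [quaternionToMatrix] <;> ring

/-- Twice the Hurwitz unit whose reduction modulo `3` has coordinates
`w, x, y, z`. -/
def doubledHurwitzLift (w x y z : ZMod 3) : ℍ[ℤ] :=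
  let c : ℤ := if w * x * y * z = 0 then 2 else -1
  ⟨c * w.valMinAbs, c * x.valMinAbs, c * y.valMinAbs, c * z.valMinAbs⟩

/-- Twice the Hurwitz unit whose matrix reduces modulo `3` to the matrix with entries
`a, b, c, d` of determinant one. -/
def doubledHurwitzUnit (a b c d : ZMod 3) : ℍ[ℤ] :=
  doubledHurwitzLift (-(a + d)) (b - c) (a + b + c - d) (b + c + d - a)

theorem doubledHurwitzUnit_mul : ∀ a b c d : ZMod 3, a * d - b * c = 1 →
    ∀ a' b' c' d' : ZMod 3, a' * d' - b' * c' = 1 →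
    2 * doubledHurwitzUnit (a * a' + b * c') (a * b' + b * d')
        (c * a' + d * c') (c * b' + d * d') =
      doubledHurwitzUnit a b c d * doubledHurwitzUnit a' b' c' d' := by
  simp only [two_mul, Quaternion.ext_iff, Quaternion.re_mul, Quaternion.imI_mul, Quaternion.imJ_mul,
    Quaternion.imK_mul, Quaternion.re_add, Quaternion.imI_add, Quaternion.imJ_add,
    Quaternion.imK_add]
  decide +kernel

theorem sq_add_sq_doubledHurwitzUnit : ∀ a b c d : ZMod 3, a * d - b * c = 1 →
    (doubledHurwitzUnit a b c d).re ^ 2 + (doubledHurwitzUnit a b c d).imI ^ 2 +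
      (doubledHurwitzUnit a b c d).imJ ^ 2 + (doubledHurwitzUnit a b c d).imK ^ 2 = 4 := by
  decide +kernel

theorem quaternionToMatrix_doubledHurwitzUnit : ∀ a b c d : ZMod 3, a * d - b * c = 1 →
    (2 : ZMod 3) • quaternionToMatrix 1 (doubledHurwitzUnit a b c d) = !![a, b; c, d] := by
  decide +kernel

theorem map_quaternionToMatrix {R S : Type*} [CommRing R] [CommRing S] (f : R →+* S) (s : R)
    (q : ℍ[ℤ]) : (quaternionToMatrix s q).map f = quaternionToMatrix (f s) q := by
  ext i j
  fin_cases i <;> fin_cases j <;> simp [quaternionToMatrix]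

theorem PadicInt.norm_two_of_three : ‖(2 : ℤ_[3])‖ = 1 := by
  refine le_antisymm (PadicInt.norm_le_one _) (not_lt.1 fun h ↦ ?_)
  have := (PadicInt.norm_int_lt_one_iff_dvd (p := 3) 2).1 (by exact_mod_cast h)
  norm_num at this

theorem PadicInt.exists_sq_eq_neg_two : ∃ s : ℤ_[3], s ^ 2 = -2 ∧ PadicInt.toZMod s = 1 := by
  have h3 : ‖(3 : ℤ_[3])‖ < 1 := by
    exact_mod_cast (PadicInt.norm_int_lt_one_iff_dvd (p := 3) 3).2 (by norm_num)
  have hd : ‖(Polynomial.X ^ 2 + 2 : Polynomial ℤ_[3]).derivative.aeval (1 : ℤ_[3])‖ = 1 := by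
    simpa [one_add_one_eq_two] using PadicInt.norm_two_of_three
  obtain ⟨s, hs, hs1, -⟩ := hensels_lemma (p := 3) (F := (Polynomial.X ^ 2 + 2 : Polynomial ℤ_[3]))
    (a := (1 : ℤ_[3])) (by
      rw [hd]
      norm_num
      exact h3)
  rw [hd] at hs1
  refine ⟨s, eq_neg_of_add_eq_zero_left (by simpa using hs), ?_⟩
  have : s - 1 ∈ RingHom.ker (PadicInt.toZMod (p := 3)) := by
    rw [PadicInt.ker_toZMod, IsLocalRing.mem_maximalIdeal]
    exact PadicInt.mem_nonunits.2 hs1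
  simpa [RingHom.mem_ker, sub_eq_zero] using this

theorem Matrix.SpecialLinearGroup.exists_section_of_sq_eq_neg_two {R : Type*} [CommRing R]
    (f : R →+* ZMod 3) {s h : R} (hs : s ^ 2 = -2) (hfs : f s = 1) (hh : 2 * h = 1) :
    ∃ ι : Matrix.SpecialLinearGroup (Fin 2) (ZMod 3) →* Matrix.SpecialLinearGroup (Fin 2) R,
      (Matrix.SpecialLinearGroup.map f).comp ι = MonoidHom.id _ := by
  have hdet (M : Matrix.SpecialLinearGroup (Fin 2) (ZMod 3)) :
      M 0 0 * M 1 1 - M 0 1 * M 1 0 = 1 := by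
    rw [← Matrix.det_fin_two, M.det_coe]
  refine ⟨MonoidHom.mk' (fun M ↦ ⟨h • quaternionToMatrix s
    (doubledHurwitzUnit (M 0 0) (M 0 1) (M 1 0) (M 1 1)), ?_⟩) fun M N ↦ ?_, ?_⟩
  · rw [Matrix.det_smul, det_quaternionToMatrix hs, sq_add_sq_doubledHurwitzUnit _ _ _ _ (hdet M),
      Fintype.card_fin]
    push_cast
    linear_combination (2 * h + 1) * hh
  · apply Subtype.ext
    have key := congrArg (quaternionToMatrix s) (doubledHurwitzUnit_mul _ _ _ _ (hdet M) _ _ _ _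
      (hdet N))
    rw [quaternionToMatrix_two_mul, quaternionToMatrix_mul hs] at key
    simp only [Matrix.SpecialLinearGroup.coe_mul, Matrix.mul_apply, Fin.sum_univ_two]
    change _ = h • quaternionToMatrix s _ * h • quaternionToMatrix s _
    rw [Matrix.smul_mul, Matrix.mul_smul, ← key, smul_smul h 2, mul_comm h, hh, one_smul]
  · have hfh : f h = 2 := by
      have h2 : 2 * f h = 1 := by rw [← map_ofNat f 2, ← map_mul, hh, map_one]
      generalize f h = x at h2
      revert x
      decide
    have hmap (q : ℍ[ℤ]) :
        (h • quaternionToMatrix s q).map f = (2 : ZMod 3) • quaternionToMatrix 1 q := by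
      rw [← hfh, ← hfs, ← map_quaternionToMatrix]
      ext i j
      simp
    ext M : 1
    exact Subtype.ext <| (hmap _).trans <|
      (quaternionToMatrix_doubledHurwitzUnit _ _ _ _ (hdet M)).trans (Matrix.eta_fin_two M.1).symm

/-- There is an injective group homomorphism
`ι : SL(2, 𝔽₃) → SL(2, ℤ₃)` that is a section of the reduction-mod-3 map
`SL(2, ℤ₃) → SL(2, 𝔽₃)`. -/
theorem exists_section_of_reduction_SL2 :
    ∃ ι : Matrix.SpecialLinearGroup (Fin 2) (ZMod 3) →*
        Matrix.SpecialLinearGroup (Fin 2) ℤ_[3],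
      Function.Injective ι ∧
      (Matrix.SpecialLinearGroup.map (PadicInt.toZMod (p := 3))).comp ι =
        MonoidHom.id (Matrix.SpecialLinearGroup (Fin 2) (ZMod 3)) := by
  obtain ⟨s, hs, hs1⟩ := PadicInt.exists_sq_eq_neg_two
  obtain ⟨h, hh⟩ := (PadicInt.isUnit_iff.2 PadicInt.norm_two_of_three).exists_right_inv
  obtain ⟨ι, hι⟩ :=
    Matrix.SpecialLinearGroup.exists_section_of_sq_eq_neg_two PadicInt.toZMod hs hs1 hh
  exact ⟨ι, Function.LeftInverse.injective (g := Matrix.SpecialLinearGroup.map PadicInt.toZMod)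
    fun M ↦ DFunLike.congr_fun hι M, hι⟩
end

section
/- Let Γ be the kernel of the reduction homomorphism SL(2, ℤ₃) → SL(2, 𝔽₃). Then Γ is topologically generated by three elements: there exist g₁, g₂, g₃ ∈ Γ such that the topological closure in SL(2, ℤ₃) of the subgroup generated by {g₁, g₂, g₃} equals Γ. -/
/-- The `3`-adic topology on `SL(2, ℤ₃)`, as a subspace of the `2 × 2` matrices. -/
noncomputable instance : TopologicalSpace (Matrix.SpecialLinearGroup (Fin 2) ℤ_[3]) :=
  inferInstanceAs (TopologicalSpace {A : Matrix (Fin 2) (Fin 2) ℤ_[3] // A.det = 1})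

/-- `Γ`, the kernel of the reduction homomorphism `SL(2, ℤ₃) → SL(2, 𝔽₃)`. -/
noncomputable def Gamma : Subgroup (Matrix.SpecialLinearGroup (Fin 2) ℤ_[3]) :=
  (Matrix.SpecialLinearGroup.map (PadicInt.toZMod (p := 3))).ker

open Matrix Matrix.SpecialLinearGroup

instance specialLinearGroup_isTopologicalGroup :
    IsTopologicalGroup (SpecialLinearGroup (Fin 2) ℤ_[3]) :=
  Matrix.SpecialLinearGroup.topologicalGroup

section Homs

variable {R : Type*} [CommRing R]

/-- Upper unitriangular matrices, as a homomorphism from the additive group of the ring. -/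
def upperUnipotent : Multiplicative R →* SpecialLinearGroup (Fin 2) R where
  toFun x := ⟨!![1, x.toAdd; 0, 1], by simp⟩
  map_one' := Subtype.ext one_fin_two.symm
  map_mul' x y := Subtype.ext <|
    show !![1, x.toAdd + y.toAdd; 0, 1] = !![1, x.toAdd; 0, 1] * !![1, y.toAdd; 0, 1] by
      simp [add_comm]

/-- Lower unitriangular matrices, as a homomorphism from the additive group of the ring. -/
def lowerUnipotent : Multiplicative R →* SpecialLinearGroup (Fin 2) R where
  toFun x := ⟨!![1, 0; x.toAdd, 1], by simp⟩
  map_one' := Subtype.ext one_fin_two.symm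
  map_mul' x y := Subtype.ext <|
    show !![1, 0; x.toAdd + y.toAdd, 1] = !![1, 0; x.toAdd, 1] * !![1, 0; y.toAdd, 1] by
      simp

/-- The diagonal torus of `SL₂`. -/
def diagonalTorus : Rˣ →* SpecialLinearGroup (Fin 2) R where
  toFun u := ⟨!![(u : R), 0; 0, ((u⁻¹ : Rˣ) : R)], by simp⟩
  map_one' := Subtype.ext (by simp [one_fin_two])
  map_mul' u v := Subtype.ext <|
    show !![((u * v : Rˣ) : R), 0; 0, (((u * v)⁻¹ : Rˣ) : R)] =
      !![(u : R), 0; 0, ((u⁻¹ : Rˣ) : R)] * !![(v : R), 0; 0, ((v⁻¹ : Rˣ) : R)] by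
      simp [mul_comm]

@[simp]
theorem coe_upperUnipotent (x : Multiplicative R) :
    (upperUnipotent x : Matrix (Fin 2) (Fin 2) R) = !![1, x.toAdd; 0, 1] := rfl

@[simp]
theorem coe_lowerUnipotent (x : Multiplicative R) :
    (lowerUnipotent x : Matrix (Fin 2) (Fin 2) R) = !![1, 0; x.toAdd, 1] := rfl

@[simp]
theorem coe_diagonalTorus (u : Rˣ) :
    (diagonalTorus u : Matrix (Fin 2) (Fin 2) R) = !![(u : R), 0; 0, ((u⁻¹ : Rˣ) : R)] := rfl

theorem eq_lowerUnipotent_mul_diagonalTorus_mul_upperUnipotent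
    (A : SpecialLinearGroup (Fin 2) R) (u : Rˣ) (hu : A 0 0 = u) :
    A = lowerUnipotent (.ofAdd (A 1 0 * ↑u⁻¹)) * diagonalTorus u *
      upperUnipotent (.ofAdd (A 0 1 * ↑u⁻¹)) := by
  have hdet := A.det_coe
  rw [Matrix.det_fin_two, hu] at hdet
  have hinv : (u : R) * ↑u⁻¹ = 1 := u.mul_inv
  ext i j
  fin_cases i <;> fin_cases j <;>
    simp [hu]
  · linear_combination (-A 0 1) * hinv
  · linear_combination (-A 1 1) * hinv + (↑u⁻¹ : R) * hdet

end Homs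

theorem continuous_upperUnipotent :
    Continuous (upperUnipotent : Multiplicative ℤ_[3] →* SpecialLinearGroup (Fin 2) ℤ_[3]) := by
  refine Continuous.subtype_mk (continuous_matrix fun i j => ?_) _
  fin_cases i <;> fin_cases j <;> simp <;> fun_prop

theorem continuous_lowerUnipotent :
    Continuous (lowerUnipotent : Multiplicative ℤ_[3] →* SpecialLinearGroup (Fin 2) ℤ_[3]) := by
  refine Continuous.subtype_mk (continuous_matrix fun i j => ?_) _
  fin_cases i <;> fin_cases j <;> simp <;> fun_prop

theorem continuous_diagonalTorus :
    Continuous (diagonalTorus : ℤ_[3]ˣ →* SpecialLinearGroup (Fin 2) ℤ_[3]) := by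
  refine Continuous.subtype_mk (continuous_matrix fun i j => ?_) _
  fin_cases i <;> fin_cases j <;> simp <;> fun_prop

theorem map_ofAdd_mul_mem_of_isClosed {p : ℕ} [Fact p.Prime] {G : Type*} [Group G]
    [TopologicalSpace G] (H : Subgroup G) (hH : IsClosed (H : Set G))
    (f : Multiplicative ℤ_[p] →* G) (hf : Continuous f) {x : ℤ_[p]}
    (hx : f (.ofAdd x) ∈ H) (z : ℤ_[p]) : f (.ofAdd (x * z)) ∈ H := by
  refine PadicInt.denseRange_intCast.induction_on (p := fun z => f (.ofAdd (x * z)) ∈ H) z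
    (hH.preimage (hf.comp (continuous_ofAdd.comp (continuous_const_mul x)))) fun n => ?_
  have h : Multiplicative.ofAdd (x * (n : ℤ_[p])) = .ofAdd x ^ n := by
    rw [← ofAdd_zsmul, zsmul_eq_mul, mul_comm]
  rw [h, map_zpow]
  exact H.zpow_mem hx n

theorem exists_four_pow_three_pow (n : ℕ) :
    ∃ w : ℤ_[3], 4 ^ 3 ^ n = 1 + 3 ^ (n + 1) * (1 + 3 * w) := by
  induction n with
  | zero => exact ⟨0, by norm_num⟩
  | succ n ih =>
    obtain ⟨w, hw⟩ := ih
    refine ⟨w + 3 ^ n * (1 + 3 * w) ^ 2 + 3 ^ (2 * n) * (1 + 3 * w) ^ 3, ?_⟩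
    rw [pow_succ 3 n, pow_mul, hw]
    ring

theorem exists_four_pow_sub_dvd (a : ℤ_[3]) (ha : 3 ∣ a - 1) (n : ℕ) :
    ∃ k : ℕ, (3 : ℤ_[3]) ^ (n + 1) ∣ a - 4 ^ k := by
  induction n with
  | zero => exact ⟨0, by simpa using ha⟩
  | succ n ih =>
    obtain ⟨k, t, ht⟩ := ih
    obtain ⟨w, hw⟩ := exists_four_pow_three_pow n
    obtain ⟨s, hs⟩ : (3 : ℤ_[3]) ∣ 4 ^ k - 1 := by
      have h := sub_one_dvd_pow_sub_one (4 : ℤ_[3]) k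
      norm_num at h
      exact h
    obtain ⟨r, hr, q, hq⟩ : ∃ r : ℕ, r < 3 ∧ (3 : ℤ_[3]) ∣ t - r :=
      ⟨t.zmodRepr, t.zmodRepr_lt_p, by
        exact_mod_cast (PadicInt.norm_lt_one_iff_dvd _).1 t.norm_sub_zmodRepr_lt_one⟩
    refine ⟨k + 3 ^ n * r, ?_⟩
    rw [pow_add 4, pow_mul, hw, eq_add_of_sub_eq ht, eq_add_of_sub_eq hs, eq_add_of_sub_eq hq]
    interval_cases r
    · exact ⟨q, by push_cast; ring⟩
    · exact ⟨q - w - s - 3 * s * w, by push_cast; ring⟩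
    · exact ⟨q - 2 * w - 2 * s - 6 * s * w - (1 + 3 * s) * 3 ^ n * (1 + 3 * w) ^ 2, by
        push_cast; ring⟩

theorem mem_closure_zpowers_of_three_dvd (v : ℤ_[3]ˣ) (hv : (v : ℤ_[3]) = 4) (u : ℤ_[3]ˣ)
    (hu : (3 : ℤ_[3]) ∣ u - 1) : u ∈ closure (Subgroup.zpowers v : Set ℤ_[3]ˣ) := by
  rw [Units.isOpenEmbedding_val.isEmbedding.closure_eq_preimage_closure_image, Set.mem_preimage,
    Metric.mem_closure_iff]
  intro ε hε
  obtain ⟨n, hn⟩ := PadicInt.exists_pow_neg_lt 3 hε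
  obtain ⟨k, hk⟩ := exists_four_pow_sub_dvd u hu n
  refine ⟨_, ⟨v ^ k, Subgroup.npow_mem_zpowers v k, rfl⟩, lt_of_le_of_lt ?_ hn⟩
  rw [dist_eq_norm, Units.val_pow_eq_pow_val, hv, PadicInt.norm_le_pow_iff_mem_span_pow,
    Ideal.mem_span_singleton]
  exact (pow_dvd_pow _ n.le_succ).trans (by exact_mod_cast hk)

theorem isUnit_of_three_dvd_sub_one {a : ℤ_[3]} (ha : 3 ∣ a - 1) : IsUnit a := by
  refine IsLocalRing.isUnit_of_mem_nonunits_one_sub_self a ?_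
  rw [PadicInt.mem_nonunits, PadicInt.norm_lt_one_iff_dvd, ← neg_sub, dvd_neg]
  exact_mod_cast ha

theorem mem_Gamma_iff (A : SpecialLinearGroup (Fin 2) ℤ_[3]) :
    A ∈ Gamma ↔ ∀ i j, (3 : ℤ_[3]) ∣ A i j - (1 : Matrix (Fin 2) (Fin 2) ℤ_[3]) i j := by
  have key (x y : ℤ_[3]) : PadicInt.toZMod x = PadicInt.toZMod y ↔ (3 : ℤ_[3]) ∣ x - y := by
    rw [← sub_eq_zero, ← map_sub, ← RingHom.mem_ker, PadicInt.ker_toZMod,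
      PadicInt.maximalIdeal_eq_span_p, Ideal.mem_span_singleton, Nat.cast_ofNat]
  simp only [← key]
  rw [Gamma, MonoidHom.mem_ker, ← map_one (SpecialLinearGroup.map (PadicInt.toZMod (p := 3)))]
  exact Matrix.SpecialLinearGroup.ext_iff _ _

theorem isClosed_Gamma : IsClosed (Gamma : Set (SpecialLinearGroup (Fin 2) ℤ_[3])) := by
  have h : (Gamma : Set (SpecialLinearGroup (Fin 2) ℤ_[3])) =
      ⋂ (i) (j), {A | ‖A i j - (1 : Matrix (Fin 2) (Fin 2) ℤ_[3]) i j‖ ≤ 3 ^ (-1 : ℤ)} := by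
    ext A
    simp only [SetLike.mem_coe, mem_Gamma_iff, Set.mem_iInter, Set.mem_ofPred_eq]
    refine forall₂_congr fun i j => ?_
    have h := PadicInt.norm_le_pow_iff_mem_span_pow
      (A i j - (1 : Matrix (Fin 2) (Fin 2) ℤ_[3]) i j) 1
    rw [Ideal.mem_span_singleton, pow_one] at h
    exact_mod_cast h.symm
  rw [h]
  refine isClosed_iInter fun i => isClosed_iInter fun j => isClosed_le ?_ continuous_const
  exact ((continuous_subtype_val.matrix_elem i j).sub continuous_const).norm

/-- `Γ = ker (SL(2, ℤ₃) → SL(2, 𝔽₃))` is topologically generated by three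
elements. -/
theorem Gamma_topologically_generated_by_three :
    ∃ g₁ g₂ g₃ : Matrix.SpecialLinearGroup (Fin 2) ℤ_[3],
      g₁ ∈ Gamma ∧ g₂ ∈ Gamma ∧ g₃ ∈ Gamma ∧
      closure ((Subgroup.closure {g₁, g₂, g₃} :
          Subgroup (Matrix.SpecialLinearGroup (Fin 2) ℤ_[3])) :
        Set (Matrix.SpecialLinearGroup (Fin 2) ℤ_[3])) =
      (Gamma : Set (Matrix.SpecialLinearGroup (Fin 2) ℤ_[3])) := by
  obtain ⟨v, hv⟩ : IsUnit (4 : ℤ_[3]) :=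
    isUnit_of_three_dvd_sub_one ⟨1, by norm_num⟩
  have hg₁ : lowerUnipotent (.ofAdd (3 : ℤ_[3])) ∈ Gamma := by
    rw [mem_Gamma_iff]
    intro i j
    fin_cases i <;> fin_cases j <;> simp
  have hg₂ : diagonalTorus v ∈ Gamma := by
    rw [mem_Gamma_iff]
    intro i j
    fin_cases i <;> fin_cases j <;> simp
    · rw [hv]
      exact ⟨1, by norm_num⟩
    · exact ⟨-(↑v⁻¹ : ℤ_[3]), by linear_combination v.mul_inv - (↑v⁻¹ : ℤ_[3]) * hv⟩
  have hg₃ : upperUnipotent (.ofAdd (3 : ℤ_[3])) ∈ Gamma := by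
    rw [mem_Gamma_iff]
    intro i j
    fin_cases i <;> fin_cases j <;> simp
  refine ⟨_, _, _, hg₁, hg₂, hg₃, ?_⟩
  set H := Subgroup.closure {lowerUnipotent (.ofAdd (3 : ℤ_[3])), diagonalTorus v,
    upperUnipotent (.ofAdd (3 : ℤ_[3]))}
  refine (closure_minimal (SetLike.coe_subset_coe.2 <| (Subgroup.closure_le _).2 ?_)
    isClosed_Gamma).antisymm fun A hA => ?_
  · simp [Set.insert_subset_iff, hg₁, hg₂, hg₃]
  change A ∈ H.topologicalClosure
  have hle : H ≤ H.topologicalClosure := H.le_topologicalClosure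
  have hclosed := H.isClosed_topologicalClosure
  have hmem := (mem_Gamma_iff A).1 hA
  obtain ⟨u, hu⟩ : IsUnit (A 0 0) := isUnit_of_three_dvd_sub_one (by simpa using hmem 0 0)
  have hu₁ : (3 : ℤ_[3]) ∣ u - 1 := by simpa [hu] using hmem 0 0
  obtain ⟨b, hb⟩ : (3 : ℤ_[3]) ∣ A 0 1 := by simpa using hmem 0 1
  obtain ⟨c, hc⟩ : (3 : ℤ_[3]) ∣ A 1 0 := by simpa using hmem 1 0
  rw [eq_lowerUnipotent_mul_diagonalTorus_mul_upperUnipotent A u hu.symm, hb, hc, mul_assoc 3 b,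
    mul_assoc 3 c]
  refine mul_mem (mul_mem ?_ ?_) ?_
  · exact map_ofAdd_mul_mem_of_isClosed _ hclosed _ continuous_lowerUnipotent
      (hle (Subgroup.subset_closure (by simp))) _
  · have hv_mem : diagonalTorus v ∈ H.topologicalClosure :=
      hle (Subgroup.subset_closure (by simp))
    refine closure_minimal (t := diagonalTorus ⁻¹' (H.topologicalClosure : Set _)) ?_
      (hclosed.preimage continuous_diagonalTorus) (mem_closure_zpowers_of_three_dvd v hv u hu₁)
    exact (Subgroup.zpowers_le (H := H.topologicalClosure.comap diagonalTorus)).2 hv_mem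
  · exact map_ofAdd_mul_mem_of_isClosed _ hclosed _ continuous_upperUnipotent
      (hle (Subgroup.subset_closure (by simp))) _
end

section
/- If A ∈ SL(2, ℤ₃) satisfies A^(3^k) = 1 for some natural number k, then A³ = 1. In other words, every element of finite 3-power order in SL(2, ℤ₃) has order dividing 3. -/
open Matrix in
theorem Matrix.SpecialLinearGroup.coe_pow_three_fin_two {R : Type*} [CommRing R]
    (A : SpecialLinearGroup (Fin 2) R) :
    ((A ^ 3 : SpecialLinearGroup (Fin 2) R) : Matrix (Fin 2) (Fin 2) R) =
      (A.1.trace ^ 2 - 1) • A.1 - A.1.trace • (1 : Matrix (Fin 2) (Fin 2) R) := by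
  have hdet := A.det_coe
  rw [det_fin_two] at hdet
  have hsq : A.1 * A.1 = A.1.trace • A.1 - 1 := by
    ext i j
    fin_cases i <;> fin_cases j <;>
      simp [mul_apply, Fin.sum_univ_two, trace_fin_two] <;>
      first | ring1 | linear_combination -hdet
  rw [SpecialLinearGroup.coe_pow, pow_succ, pow_two, hsq, sub_mul, smul_mul_assoc, hsq, one_mul]
  module

theorem Matrix.SpecialLinearGroup.trace_pow_three_fin_two {R : Type*} [CommRing R]
    (A : Matrix.SpecialLinearGroup (Fin 2) R) :
    (A ^ 3).1.trace = A.1.trace ^ 3 - 3 * A.1.trace := by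
  rw [coe_pow_three_fin_two, Matrix.trace_sub, Matrix.trace_smul, Matrix.trace_smul,
    Matrix.trace_one, Fintype.card_fin]
  simp only [smul_eq_mul]
  push_cast
  ring

theorem PadicInt.cube_sub_three_mul_ne_neg_one (t : ℤ_[3]) : t ^ 3 - 3 * t ≠ -1 := by
  intro h
  have h9 := congrArg (PadicInt.toZModPow (p := 3) 2) h
  simp only [map_sub, map_pow, map_mul, map_neg, map_one, map_ofNat] at h9
  have key : ∀ x : ZMod (3 ^ 2), x ^ 3 - 3 * x ≠ -1 := by decide
  exact key _ h9

theorem SL2_Zp3_pow_three_eq_one_of_pow_nine_eq_one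
    (B : Matrix.SpecialLinearGroup (Fin 2) ℤ_[3]) (hB : (B ^ 3) ^ 3 = 1) : B ^ 3 = 1 := by
  have hs := (B ^ 3).trace_pow_three_fin_two
  have hne : (B ^ 3).1.trace ≠ -1 :=
    B.trace_pow_three_fin_two ▸ PadicInt.cube_sub_three_mul_ne_neg_one _
  have hC := (B ^ 3).coe_pow_three_fin_two
  rw [hB] at hs hC
  generalize B ^ 3 = C at *
  rw [Matrix.SpecialLinearGroup.coe_one] at hs hC
  rw [Matrix.trace_one, Fintype.card_fin] at hs
  push_cast at hs
  have hfactor : (C.1.trace - 2) * (C.1.trace + 1) ^ 2 = 0 := by linear_combination -hs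
  have htwo : C.1.trace = 2 := by
    rcases mul_eq_zero.mp hfactor with h | h
    · exact sub_eq_zero.mp h
    · exact absurd (eq_neg_of_add_eq_zero_left (pow_eq_zero_iff two_ne_zero |>.mp h)) hne
  rw [htwo] at hC
  ext i j
  have hij := congrFun (congrFun hC i) j
  simp only [Matrix.sub_apply, Matrix.smul_apply, smul_eq_mul] at hij
  rw [Matrix.SpecialLinearGroup.coe_one]
  have hthree : (3 : ℤ_[3]) * C.1 i j = 3 * (1 : Matrix (Fin 2) (Fin 2) ℤ_[3]) i j := by
    linear_combination -hij
  exact mul_left_cancel₀ (OfNat.ofNat_ne_zero 3) hthree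

/-- Every element of `SL(2, ℤ₃)` of finite `3`-power order has order
dividing `3`: if `A ^ (3 ^ k) = 1` then `A ^ 3 = 1`. -/
theorem SL2_Zp3_three_power_torsion
    (A : Matrix.SpecialLinearGroup (Fin 2) ℤ_[3]) (k : ℕ) (hA : A ^ (3 ^ k) = 1) :
    A ^ 3 = 1 := by
  induction k with
  | zero => rw [pow_zero, pow_one] at hA; rw [hA, one_pow]
  | succ k ih =>
    cases k with
    | zero => simpa using hA
    | succ k =>
      apply ih
      rw [pow_succ, pow_mul]
      apply SL2_Zp3_pow_three_eq_one_of_pow_nine_eq_one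
      rwa [← pow_mul (A ^ 3 ^ k), ← pow_mul, ← mul_assoc, ← pow_succ, ← pow_succ]
end

section
/- Let E be a field that is an algebra over the field ℚ₃ of 3-adic numbers, finite-dimensional with dim_{ℚ₃} E ≤ 2. If t ∈ E satisfies t^(3^k) = 1 for some natural number k, then t³ = 1. (Equivalently, the only 3-power roots of unity lying in an extension of ℚ₃ of degree at most 2 are the cube roots of unity; the unique quadratic subfield of ℚ₃(ζ_{3^k}) is ℚ₃(ζ₃).) -/
open Polynomial in
/-- The `p ^ (n + 1)`-th cyclotomic polynomial is irreducible over `ℚ_[p]`. -/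
theorem Padic.irreducible_cyclotomic_prime_pow (p : ℕ) [hp : Fact p.Prime] (n : ℕ) :
    Irreducible (cyclotomic (p ^ (n + 1)) ℚ_[p]) := by
  have hZ := cyclotomic_prime_pow_comp_X_add_one_isEisensteinAt p n
  have hmap : ((cyclotomic (p ^ (n + 1)) ℤ).comp (X + 1)).map (Int.castRingHom ℤ_[p]) =
      (cyclotomic (p ^ (n + 1)) ℤ_[p]).comp (X + C 1) := by
    simp [Polynomial.map_comp]
  have hmonicZ : ((cyclotomic (p ^ (n + 1)) ℤ).comp (X + 1)).Monic := by
    simpa using (cyclotomic.monic (p ^ (n + 1)) ℤ).comp_X_add_C 1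
  have hmonic : ((cyclotomic (p ^ (n + 1)) ℤ_[p]).comp (X + C 1)).Monic :=
    (cyclotomic.monic _ _).comp_X_add_C 1
  have hprime : (Ideal.span {(p : ℤ_[p])}).IsPrime :=
    (Ideal.span_singleton_prime PadicInt.prime_p.ne_zero).2 PadicInt.prime_p
  have hcomp : Irreducible ((cyclotomic (p ^ (n + 1)) ℤ_[p]).comp (X + C 1)) := by
    refine (hmonic.isEisensteinAt_of_mem_of_notMem hprime.ne_top (fun {i} hi => ?_) ?_).irreducible
      hprime hmonic.isPrimitive ?_
    · rw [← hmap, hmonicZ.natDegree_map] at hi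
      have h := hZ.mem hi
      rw [Ideal.submodule_span_eq, Ideal.mem_span_singleton] at h
      rw [← hmap, coeff_map, Ideal.mem_span_singleton]
      simpa using (Int.castRingHom ℤ_[p]).map_dvd h
    · have h := hZ.notMem
      rw [Ideal.submodule_span_eq, Ideal.span_singleton_pow, Ideal.mem_span_singleton] at h
      rw [← hmap, coeff_map, Ideal.span_singleton_pow, Ideal.mem_span_singleton, eq_intCast,
        PadicInt.pow_p_dvd_int_iff]
      exact h
    · rw [natDegree_comp, natDegree_X_add_C, mul_one, natDegree_cyclotomic]
      exact Nat.totient_pos.2 (pow_pos hp.out.pos _)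
  have hirr : Irreducible (cyclotomic (p ^ (n + 1)) ℤ_[p]) :=
    (MulEquiv.irreducible_iff (taylorEquiv (1 : ℤ_[p]))).1 hcomp
  simpa using (cyclotomic.monic (p ^ (n + 1)) ℤ_[p]).irreducible_iff_irreducible_map_fraction_map
    (K := ℚ_[p]) |>.1 hirr

/-- A finite extension of `ℚ_[p]` containing a primitive `p ^ (n + 1)`-th root of unity has degree
at least `φ (p ^ (n + 1))`. -/
theorem Padic.totient_le_finrank_of_isPrimitiveRoot {p : ℕ} [hp : Fact p.Prime] {E : Type*}
    [Field E] [Algebra ℚ_[p] E] [FiniteDimensional ℚ_[p] E] {ζ : E} {n : ℕ}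
    (hζ : IsPrimitiveRoot ζ (p ^ (n + 1))) :
    (p ^ (n + 1)).totient ≤ Module.finrank ℚ_[p] E := by
  have : NeZero ((p ^ (n + 1) : ℕ) : ℚ_[p]) := ⟨by exact_mod_cast (pow_pos hp.out.pos _).ne'⟩
  rw [← Polynomial.natDegree_cyclotomic (p ^ (n + 1)) ℚ_[p],
    hζ.minpoly_eq_cyclotomic_of_irreducible (Padic.irreducible_cyclotomic_prime_pow p n)]
  exact minpoly.natDegree_le ζ

/-- In any field extension `E` of `ℚ₃` of degree at most `2`, the only
`3`-power roots of unity are the cube roots of unity: if `t ^ (3 ^ k) = 1` then `t ^ 3 = 1`.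
(Equivalently, the unique quadratic subfield of `ℚ₃(ζ_{3^k})` is `ℚ₃(ζ₃)`.) -/
theorem three_power_roots_of_unity_in_quadratic_ext_of_Q3
    (E : Type) [Field E] [Algebra ℚ_[3] E] [FiniteDimensional ℚ_[3] E]
    (hE : Module.finrank ℚ_[3] E ≤ 2) (t : E) (k : ℕ) (ht : t ^ (3 ^ k) = 1) :
    t ^ 3 = 1 := by
  obtain ⟨m, -, hm⟩ := (Nat.dvd_prime_pow Nat.prime_three).1 (orderOf_dvd_of_pow_eq_one ht)
  have hroot : IsPrimitiveRoot t (3 ^ m) := hm ▸ IsPrimitiveRoot.orderOf t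
  match m with
  | 0 => simp_all
  | 1 => simpa using hroot.pow_eq_one
  | m + 2 =>
    have h := (Padic.totient_le_finrank_of_isPrimitiveRoot hroot).trans hE
    rw [Nat.totient_prime_pow_succ Nat.prime_three, pow_succ] at h
    have : 0 < 3 ^ m := by positivity
    omega
end
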